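/- arXiv:1109.6560 — 3 statements merged into one kernel-verified Lean document; each statement's English description precedes it below -/
import Mathlib

section
/- For |q|<1, Ramanujan's third order mock theta function f(q) := 1 + ∑_{n≥1} q^{n²}/((-q;q)_n)² equals the series f⋆(q) := 1 + ∑_{n≥1} (−1)^{n+1} q^n/(−q;q)_n. -/
noncomputable def qPoch (a q : ℂ) (n : ℕ) : ℂ :=
  ∏ j ∈ Finset.range n, (1 - a * q ^ j)

lemma aux_succ (q : ℂ) (n : ℕ) :
    qPoch (-q) q (n + 1) = qPoch (-q) q n * (1 + q ^ (n + 1)) := by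
  unfold qPoch
  rw [Finset.prod_range_succ]
  ring

lemma aux_fac (q : ℂ) (hq : ‖q‖ < 1) (n : ℕ) : 1 + q ^ (n + 1) ≠ 0 := by
  intro h
  have h1 : q ^ (n + 1) = -1 := by linear_combination h
  have h2 : ‖q‖ ^ (n + 1) = 1 := by rw [← norm_pow, h1]; simp
  have := pow_lt_one₀ (norm_nonneg q) hq (Nat.succ_ne_zero n)
  simp at this
  linarith

lemma aux_ne (q : ℂ) (hq : ‖q‖ < 1) (n : ℕ) : qPoch (-q) q n ≠ 0 := by
  induction n with
  | zero => simp [qPoch]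
  | succ n ih => rw [aux_succ]; exact mul_ne_zero ih (aux_fac q hq n)

lemma aux_bdd (q : ℂ) (hq : ‖q‖ < 1) : ∃ C : ℝ, 0 ≤ C ∧ ∀ n, ‖(qPoch (-q) q n)⁻¹‖ ≤ C := by
  have hs : Summable (fun n : ℕ => ‖q ^ (n + 1)‖) := by
    simp only [norm_pow]
    exact (summable_nat_add_iff 1).2 (summable_geometric_of_lt_one (norm_nonneg q) hq)
  have hne := tprod_one_add_ne_zero_of_summable (f := fun n : ℕ => q ^ (n + 1))
    (aux_fac q hq) hs
  have hm := (multipliable_one_add_of_summable hs).hasProd.tendsto_prod_nat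
  have hP : (fun n => ∏ i ∈ Finset.range n, (1 + q ^ (i + 1))) = qPoch (-q) q := by
    funext n
    unfold qPoch
    refine Finset.prod_congr rfl fun i _ => by ring
  rw [hP] at hm
  have h2 := (hm.inv₀ hne).norm
  obtain ⟨C, hC⟩ := h2.bddAbove_range
  have h3 : ∀ n, ‖(qPoch (-q) q n)⁻¹‖ ≤ C := fun n => hC ⟨n, rfl⟩
  exact ⟨C, (norm_nonneg _).trans (h3 0), h3⟩

noncomputable def tt (q : ℂ) (k n : ℕ) : ℂ :=
  (-1) ^ n * q ^ (k ^ 2 + k + (k + 1) * n) / (qPoch (-q) q k * qPoch (-q) q (k + n))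

lemma tt_bound (q : ℂ) (hq : ‖q‖ < 1) (C : ℝ) (hC : 0 ≤ C)
    (h : ∀ n, ‖(qPoch (-q) q n)⁻¹‖ ≤ C) (k n : ℕ) :
    ‖tt q k n‖ ≤ (C * C * ‖q‖ ^ k) * ‖q‖ ^ n := by
  unfold tt
  rw [div_eq_mul_inv, mul_inv, norm_mul, norm_mul, norm_mul, norm_pow, norm_pow]
  have h1 : ‖q‖ ^ (k ^ 2 + k + (k + 1) * n) ≤ ‖q‖ ^ (k + n) :=
    pow_le_pow_of_le_one (norm_nonneg q) hq.le (by nlinarith [Nat.zero_le (k * n), sq_nonneg k])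
  have h2 := mul_le_mul (h k) (h (k + n)) (norm_nonneg _) hC
  have h3 := mul_le_mul h1 h2 (by positivity) (by positivity)
  simp only [norm_neg, norm_one, one_pow, one_mul]
  refine h3.trans (le_of_eq ?_)
  ring

lemma tt_summable (q : ℂ) (hq : ‖q‖ < 1) (k : ℕ) : Summable (tt q k) := by
  obtain ⟨C, hC, h⟩ := aux_bdd q hq
  exact Summable.of_norm_bounded
    ((summable_geometric_of_lt_one (norm_nonneg q) hq).mul_left _) (tt_bound q hq C hC h k)

lemma tt_step (q : ℂ) (hq : ‖q‖ < 1) (k n : ℕ) :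
    tt q k n - tt q (k + 1) n = (tt q k n - tt q k (n + 1)) / (1 + q ^ (k + 1)) := by
  unfold tt
  rw [show k + 1 + n = k + n + 1 by ring, show k + (n + 1) = k + n + 1 by ring,
    aux_succ, aux_succ]
  have h1 := aux_ne q hq k
  have h2 := aux_ne q hq (k + n)
  have h3 := aux_fac q hq k
  have h4 := aux_fac q hq (k + n)
  generalize qPoch (-q) q k = A at *
  generalize qPoch (-q) q (k + n) = B at *
  rw [show (k + 1) ^ 2 + (k + 1) + (k + 1 + 1) * n
    = (k ^ 2 + k + (k + 1) * n) + (k + 1) + (k + n + 1) by ring,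
    show k ^ 2 + k + (k + 1) * (n + 1) = (k ^ 2 + k + (k + 1) * n) + (k + 1) by ring,
    pow_add q (k ^ 2 + k + (k + 1) * n + (k + 1)), pow_add q (k ^ 2 + k + (k + 1) * n) (k + 1),
    pow_succ (-1 : ℂ) n]
  generalize q ^ (k ^ 2 + k + (k + 1) * n) = X at *
  generalize q ^ (k + 1) = Y at *
  generalize q ^ (k + n + 1) = Z at *
  generalize (-1 : ℂ) ^ n = e at *
  field_simp
  ring

lemma T_step (q : ℂ) (hq : ‖q‖ < 1) (k : ℕ) :
    ∑' n, tt q k n - ∑' n, tt q (k + 1) n = tt q k 0 / (1 + q ^ (k + 1)) := by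
  have hs := tt_summable q hq k
  rw [← hs.tsum_sub (tt_summable q hq (k + 1))]
  simp_rw [tt_step q hq]
  rw [tsum_div_const, hs.tsum_sub ((summable_nat_add_iff 1).2 hs), hs.tsum_eq_zero_add]
  ring

lemma partial_sum (q : ℂ) (hq : ‖q‖ < 1) (N : ℕ) :
    ∑ n ∈ Finset.range N, q ^ ((n + 1) ^ 2) / (qPoch (-q) q (n + 1)) ^ 2
      = 1 - ∑' n, tt q 0 n + ∑' n, tt q N n - tt q N 0 := by
  induction N with
  | zero => simp [tt, qPoch]
  | succ N ih =>
    rw [Finset.sum_range_succ, ih]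
    have h := T_step q hq N
    have : q ^ ((N + 1) ^ 2) / (qPoch (-q) q (N + 1)) ^ 2
      = tt q N 0 - tt q (N + 1) 0 - tt q N 0 / (1 + q ^ (N + 1)) := by
      unfold tt
      simp only [add_zero, mul_zero, pow_zero, one_mul]
      rw [aux_succ]
      have h1 := aux_ne q hq N
      have h3 := aux_fac q hq N
      generalize qPoch (-q) q N = A at *
      rw [show (N + 1) ^ 2 = N ^ 2 + N + (N + 1) by ring,
        pow_add q (N ^ 2 + N + (N + 1)), pow_add q (N ^ 2 + N)]
      generalize q ^ (N ^ 2 + N) = X at *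
      generalize q ^ (N + 1) = Y at *
      field_simp
      ring
    rw [this]
    linear_combination h

theorem f_eq_fstar (q : ℂ) (hq : ‖q‖ < 1) :
    1 + ∑' n : ℕ, q ^ ((n + 1) ^ 2) / (qPoch (-q) q (n + 1)) ^ 2
      = 1 + ∑' n : ℕ, (-1) ^ n * q ^ (n + 1) / qPoch (-q) q (n + 1) := by
  obtain ⟨C, hC, h⟩ := aux_bdd q hq
  have hg := summable_geometric_of_lt_one (norm_nonneg q) hq
  have hg0 := tendsto_pow_atTop_nhds_zero_of_lt_one (norm_nonneg q) hq
  have hsum : Summable (fun n : ℕ => q ^ ((n + 1) ^ 2) / (qPoch (-q) q (n + 1)) ^ 2) := by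
    refine Summable.of_norm_bounded (hg.mul_left (C * C)) fun n => ?_
    rw [div_eq_mul_inv, ← inv_pow, norm_mul, norm_pow, norm_pow, mul_comm (C * C), sq ‖_‖]
    refine mul_le_mul (pow_le_pow_of_le_one (norm_nonneg q) hq.le (by nlinarith))
      (mul_le_mul (h _) (h _) (norm_nonneg _) hC) (by positivity) (by positivity)
  have hb : ∀ k, ‖∑' n, tt q k n‖ ≤ C * C * (∑' n : ℕ, ‖q‖ ^ n) * ‖q‖ ^ k := fun k => by
    have := tsum_of_norm_bounded (hg.mul_left (C * C * ‖q‖ ^ k)).hasSum (tt_bound q hq C hC h k)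
    rw [tsum_mul_left] at this
    linarith
  have hT : Filter.Tendsto (fun k => ∑' n, tt q k n) Filter.atTop (nhds 0) :=
    squeeze_zero_norm hb (by simpa using hg0.const_mul (C * C * (∑' n : ℕ, ‖q‖ ^ n)))
  have hw : Filter.Tendsto (fun k => tt q k 0) Filter.atTop (nhds 0) :=
    squeeze_zero_norm (fun k => tt_bound q hq C hC h k 0)
      (by simpa using hg0.const_mul (C * C))
  have hl := hsum.hasSum.tendsto_sum_nat
  simp_rw [partial_sum q hq] at hl
  have hr := (hT.const_add (1 - ∑' n, tt q 0 n)).sub hw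
  have key := tendsto_nhds_unique hl hr
  rw [key, (tt_summable q hq 0).tsum_eq_zero_add]
  have h0 : tt q 0 0 = 1 := by simp [tt, qPoch]
  have h1 : ∀ n, tt q 0 (n + 1) = -((-1) ^ n * q ^ (n + 1) / qPoch (-q) q (n + 1)) := fun n => by
    have : qPoch (-q) q 0 = 1 := by simp [qPoch]
    simp only [tt, this, zero_add, one_mul]
    ring
  simp_rw [h0, h1, tsum_neg]
  ring
end

section
/- For |q|<1, the series f⋆ evaluated at q^{-1}, i.e. 1 + ∑_{n≥1} (−1)^{n+1} q^{-n}/(−q^{-1};q^{-1})_n, equals 1 − ∑_{n≥1} (−1)^n q^{n(n−1)/2}/(−q;q)_n, and this equals 2ψ(q) where ψ(q) = ∑_{n≥0} q^{n(3n+1)/2}(1−q^{2n+1}). -/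
lemma fs_tri (n : ℕ) : (n + 1) * (n + 1 + 1) / 2 = n * (n + 1) / 2 + (n + 1) := by
  have : (n + 1) * (n + 1 + 1) = n * (n + 1) + (n + 1) * 2 := by ring
  rw [this, Nat.add_mul_div_right _ _ (by norm_num)]

lemma fs_pent (n : ℕ) : (n + 1) * (3 * (n + 1) + 1) / 2 = n * (3 * n + 1) / 2 + (3 * n + 2) := by
  have : (n + 1) * (3 * (n + 1) + 1) = n * (3 * n + 1) + (3 * n + 2) * 2 := by ring
  rw [this, Nat.add_mul_div_right _ _ (by norm_num)]

lemma fs_pow_le (q : ℂ) (hq : ‖q‖ < 1) (m : ℕ) : 1 - ‖q‖ ≤ ‖1 + q ^ (m + 1)‖ := by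
  have h1 : ‖q ^ (m + 1)‖ ≤ ‖q‖ := by
    rw [norm_pow]
    exact pow_le_of_le_one (norm_nonneg _) hq.le (by omega)
  have h2 := norm_sub_norm_le (1 : ℂ) (-q ^ (m + 1))
  rw [norm_neg, sub_neg_eq_add, norm_one] at h2
  linarith

lemma fs_ne (q : ℂ) (hq : ‖q‖ < 1) (m : ℕ) : 1 + q ^ (m + 1) ≠ 0 := by
  have := fs_pow_le q hq m
  intro h
  rw [h, norm_zero] at this
  linarith

lemma fs_poch_le (q : ℂ) (hq : ‖q‖ < 1) (k n : ℕ) :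
    (1 - ‖q‖) ^ n ≤ ‖qPoch (-q ^ (k + 1)) q n‖ := by
  unfold qPoch
  rw [norm_prod]
  calc (1 - ‖q‖) ^ n = ∏ j ∈ Finset.range n, (1 - ‖q‖) := by simp
    _ ≤ _ := by
      apply Finset.prod_le_prod
      · intros; linarith
      · intro j _
        have := fs_pow_le q hq (k + j)
        have e : 1 - -q ^ (k + 1) * q ^ j = 1 + q ^ (k + j + 1) := by ring
        rw [e]
        exact this

lemma fs_poch_ne (q : ℂ) (hq : ‖q‖ < 1) (k n : ℕ) : qPoch (-q ^ (k + 1)) q n ≠ 0 := by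
  have := fs_poch_le q hq k n
  have h2 : 0 < (1 - ‖q‖) ^ n := pow_pos (by linarith) n
  intro h
  rw [h, norm_zero] at this
  linarith

lemma fs_poch_succ (q : ℂ) (k n : ℕ) :
    qPoch (-q ^ (k + 1)) q (n + 1) = qPoch (-q ^ (k + 1)) q n * (1 + q ^ (k + n + 1)) := by
  unfold qPoch
  rw [Finset.prod_range_succ]
  ring

lemma fs_poch_succ' (q : ℂ) (k n : ℕ) :
    qPoch (-q ^ (k + 1)) q (n + 1) = (1 + q ^ (k + 1)) * qPoch (-q ^ (k + 1 + 1)) q n := by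
  unfold qPoch
  rw [Finset.prod_range_succ', mul_comm]
  congr 1
  · ring
  · apply Finset.prod_congr rfl
    intros; ring

noncomputable def fsU (q : ℂ) (k n : ℕ) : ℂ :=
  (-1) ^ n * q ^ (2 * k * n) * q ^ (n * (n + 1) / 2) / qPoch (-q ^ (k + 1)) q n

noncomputable def fsM (r : ℝ) (n : ℕ) : ℝ := r ^ (n * (n + 1) / 2) / (1 - r) ^ n

lemma fsM_summable (r : ℝ) (h0 : 0 < r) (h1 : r < 1) : Summable (fsM r) := by
  have hc : 0 < 1 - r := by linarith
  have hpos : ∀ n, 0 < fsM r n := fun n => by unfold fsM; positivity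
  apply summable_of_ratio_test_tendsto_lt_one (l := 0) (by norm_num)
  · exact Filter.Eventually.of_forall fun n => (hpos n).ne'
  · have : (fun n => ‖fsM r (n + 1)‖ / ‖fsM r n‖) = fun n => r ^ n * (r / (1 - r)) := by
      funext n
      rw [Real.norm_of_nonneg (hpos _).le, Real.norm_of_nonneg (hpos _).le]
      unfold fsM
      rw [fs_tri, pow_add, pow_succ (1 - r)]
      field_simp
      ring
    rw [this]
    simpa using (tendsto_pow_atTop_nhds_zero_of_lt_one h0.le h1).mul_const (r / (1 - r))

lemma fsU_le (q : ℂ) (hq : ‖q‖ < 1) (k n : ℕ) : ‖fsU q k n‖ ≤ fsM ‖q‖ n := by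
  unfold fsU fsM
  have h2 : 0 < (1 - ‖q‖) ^ n := pow_pos (by linarith) n
  rw [norm_div]
  apply div_le_div₀ (by positivity) _ h2 (fs_poch_le q hq k n)
  simp only [norm_mul, norm_pow, norm_neg, norm_one, one_pow, one_mul]
  exact mul_le_of_le_one_left (by positivity) (pow_le_one₀ (norm_nonneg _) hq.le)

lemma fsU_summable (q : ℂ) (hq : ‖q‖ < 1) (hq0 : q ≠ 0) (k : ℕ) : Summable (fsU q k) :=
  Summable.of_norm_bounded (fsM_summable _ (norm_pos_iff.2 hq0) hq) (fsU_le q hq k)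

lemma fsU_succ (q : ℂ) (hq : ‖q‖ < 1) (k n : ℕ) :
    fsU q k (n + 1) * (1 + q ^ (k + n + 1)) = - fsU q k n * q ^ (2 * k) * q ^ (n + 1) := by
  have h1 := fs_poch_ne q hq k n
  have h2 := fs_ne q hq (k + n)
  unfold fsU
  rw [fs_poch_succ, fs_tri]
  field_simp
  ring

lemma fsU_shift (q : ℂ) (hq : ‖q‖ < 1) (k n : ℕ) :
    fsU q (k + 1) n * (1 + q ^ (k + n + 1)) = fsU q k n * q ^ (2 * n) * (1 + q ^ (k + 1)) := by
  have h1 := fs_poch_ne q hq k n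
  have h2 := fs_poch_ne q hq (k + 1) n
  have h3 := (fs_poch_succ q k n).symm.trans (fs_poch_succ' q k n)
  unfold fsU
  rw [div_mul_eq_mul_div, div_mul_eq_mul_div, div_mul_eq_mul_div, div_eq_div_iff h2 h1]
  have e : q ^ (2 * (k + 1) * n) = q ^ (2 * k * n) * q ^ (2 * n) := by ring
  rw [e]
  linear_combination ((-1) ^ n * (q ^ (2 * k * n) * q ^ (2 * n)) * q ^ (n * (n + 1) / 2)) * h3

lemma fs_tele (q : ℂ) (hq : ‖q‖ < 1) (k n : ℕ) :
    fsU q k n - q ^ (3 * k + 2) * fsU q (k + 1) n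
      = fsU q k n * (1 - q ^ (2 * k + n + 1)) - fsU q k (n + 1) * (1 - q ^ (2 * k + (n + 1) + 1)) := by
  apply mul_right_cancel₀ (fs_ne q hq (k + n))
  have a := fsU_succ q hq k n
  have b := fsU_shift q hq k n
  linear_combination (-q ^ (3 * k + 2)) * b + (1 - q ^ (2 * k + (n + 1) + 1)) * a

lemma fs_step (q : ℂ) (hq : ‖q‖ < 1) (hq0 : q ≠ 0) (k : ℕ) :
    ∑' n, fsU q k n = (1 - q ^ (2 * k + 1)) + q ^ (3 * k + 2) * ∑' n, fsU q (k + 1) n := by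
  have s0 := fsU_summable q hq hq0 k
  have s1 := fsU_summable q hq hq0 (k + 1)
  have hs := (s0.hasSum.sub (s1.hasSum.mul_left (q ^ (3 * k + 2)))).tendsto_sum_nat
  have hz : Filter.Tendsto (fun n => fsU q k n * (1 - q ^ (2 * k + n + 1))) Filter.atTop
      (nhds 0) := by
    have t1 := s0.tendsto_atTop_zero
    have t2 : Filter.Tendsto (fun n : ℕ => 1 - q ^ n * q ^ (2 * k + 1)) Filter.atTop
      (nhds (1 - 0 * q ^ (2 * k + 1))) :=
      ((tendsto_pow_atTop_nhds_zero_of_norm_lt_one hq).mul_const _).const_sub 1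
    have := t1.mul t2
    rw [zero_mul] at this
    refine this.congr fun n => ?_
    ring
  have e : ∀ N, ∑ n ∈ Finset.range N, (fsU q k n - q ^ (3 * k + 2) * fsU q (k + 1) n)
      = (1 - q ^ (2 * k + 1)) - fsU q k N * (1 - q ^ (2 * k + N + 1)) := by
    intro N
    rw [Finset.sum_congr rfl (fun n _ => fs_tele q hq k n)]
    rw [Finset.sum_range_sub' (fun n => fsU q k n * (1 - q ^ (2 * k + n + 1)))]
    simp [fsU, qPoch]
  simp only [e] at hs
  have := tendsto_nhds_unique hs (hz.const_sub _)
  linear_combination this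

lemma fs_iter (q : ℂ) (hq : ‖q‖ < 1) (hq0 : q ≠ 0) (k : ℕ) :
    ∑ n ∈ Finset.range k, q ^ (n * (3 * n + 1) / 2) * (1 - q ^ (2 * n + 1))
      = ∑' n, fsU q 0 n - q ^ (k * (3 * k + 1) / 2) * ∑' n, fsU q k n := by
  induction k with
  | zero => simp
  | succ k ih =>
    rw [Finset.sum_range_succ, ih, fs_step q hq hq0 k, fs_pent, pow_add]
    ring

lemma fs_le_pent (n : ℕ) : n ≤ n * (3 * n + 1) / 2 := by
  induction n with
  | zero => simp
  | succ n ih => rw [fs_pent]; omega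

lemma fs_psi (q : ℂ) (hq : ‖q‖ < 1) (hq0 : q ≠ 0) :
    ∑' n : ℕ, q ^ (n * (3 * n + 1) / 2) * (1 - q ^ (2 * n + 1)) = ∑' n, fsU q 0 n := by
  have hb : ∀ n : ℕ, ‖q ^ (n * (3 * n + 1) / 2)‖ ≤ ‖q‖ ^ n := fun n => by
    rw [norm_pow]
    exact pow_le_pow_of_le_one (norm_nonneg _) hq.le (fs_le_pent n)
  have hg := summable_geometric_of_lt_one (norm_nonneg q) hq
  have hs : Summable fun n : ℕ => q ^ (n * (3 * n + 1) / 2) * (1 - q ^ (2 * n + 1)) := by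
    refine Summable.of_norm_bounded (hg.mul_right 2) fun n => ?_
    rw [norm_mul]
    refine mul_le_mul (hb n) ?_ (norm_nonneg _) (by positivity)
    refine (norm_sub_le _ _).trans ?_
    rw [norm_one, norm_pow]
    have := pow_le_one₀ (n := 2 * n + 1) (norm_nonneg q) hq.le
    linarith
  have ht := hs.hasSum.tendsto_sum_nat
  have hM := fsM_summable _ (norm_pos_iff.2 hq0) hq
  have hz : Filter.Tendsto (fun k : ℕ => q ^ (k * (3 * k + 1) / 2) * ∑' n, fsU q k n)
      Filter.atTop (nhds 0) := by
    have t := (tendsto_pow_atTop_nhds_zero_of_lt_one (norm_nonneg q) hq).mul_const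
      (∑' n, fsM ‖q‖ n)
    rw [zero_mul] at t
    refine squeeze_zero_norm (fun k => ?_) t
    rw [norm_mul]
    exact mul_le_mul (hb k) (tsum_of_norm_bounded hM.hasSum (fsU_le q hq k)) (norm_nonneg _)
      (by positivity)
  simp only [fs_iter q hq hq0] at ht
  have := tendsto_nhds_unique ht (hz.const_sub _)
  simpa using this

lemma fs_b (q : ℂ) (hq : ‖q‖ < 1) (n : ℕ) :
    (-1) ^ (n + 1) * q ^ ((n + 1) * n / 2) / qPoch (-q) q (n + 1)
      = -(fsU q 0 n + fsU q 0 (n + 1)) := by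
  have h1 := fs_poch_ne q hq 0 n
  have h2 := fs_ne q hq n
  have h3 := fs_poch_succ q 0 n
  simp only [zero_add, pow_one] at h1 h3
  unfold fsU
  simp only [zero_add, pow_one]
  rw [h3, fs_tri, mul_comm (n + 1) n]
  field_simp
  ring

lemma fs_inv (q : ℂ) (hq : ‖q‖ < 1) (hq0 : q ≠ 0) (n : ℕ) :
    (q⁻¹) ^ (n + 1) / qPoch (-q⁻¹) q⁻¹ (n + 1)
      = q ^ ((n + 1) * n / 2) / qPoch (-q) q (n + 1) := by
  have key : ∀ n, qPoch (-q⁻¹) q⁻¹ n * q ^ (n * (n + 1) / 2) = qPoch (-q) q n := by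
    intro n
    induction n with
    | zero => simp [qPoch]
    | succ n ih =>
      have e1 : qPoch (-q⁻¹) q⁻¹ (n + 1) = qPoch (-q⁻¹) q⁻¹ n * (1 + (q ^ (n + 1))⁻¹) := by
        unfold qPoch; rw [Finset.prod_range_succ, ← inv_pow]; ring
      have e2 : qPoch (-q) q (n + 1) = qPoch (-q) q n * (1 + q ^ (n + 1)) := by
        unfold qPoch; rw [Finset.prod_range_succ]; ring
      rw [e1, e2, fs_tri, pow_add q (n * (n + 1) / 2), ← ih]
      have := pow_ne_zero (n + 1) hq0
      have e3 : (1 + (q ^ (n + 1))⁻¹) * q ^ (n + 1) = 1 + q ^ (n + 1) := by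
        rw [add_mul, inv_mul_cancel₀ this]; ring
      rw [← e3]; ring
  have h1 := fs_poch_ne q hq 0 (n + 1)
  simp only [zero_add, pow_one] at h1
  have k := key (n + 1)
  have h2 : qPoch (-q⁻¹) q⁻¹ (n + 1) ≠ 0 := by
    intro h; rw [h, zero_mul] at k; exact h1 k.symm
  rw [div_eq_div_iff h2 h1, ← k, fs_tri, pow_add q (n * (n + 1) / 2), mul_comm (n + 1) n, inv_pow]
  have e := inv_mul_cancel₀ (pow_ne_zero (n + 1) hq0)
  linear_combination (qPoch (-q⁻¹) q⁻¹ (n + 1) * q ^ (n * (n + 1) / 2)) * e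

theorem fstar_inverse (q : ℂ) (hq : ‖q‖ < 1) (hq0 : q ≠ 0) :
    (1 + ∑' n : ℕ, (-1) ^ n * (q⁻¹) ^ (n + 1) / qPoch (-q⁻¹) q⁻¹ (n + 1)
        = 1 - ∑' n : ℕ, (-1) ^ (n + 1) * q ^ ((n + 1) * n / 2) / qPoch (-q) q (n + 1)) ∧
    (1 - ∑' n : ℕ, (-1) ^ (n + 1) * q ^ ((n + 1) * n / 2) / qPoch (-q) q (n + 1)
        = 2 * ∑' n : ℕ, q ^ (n * (3 * n + 1) / 2) * (1 - q ^ (2 * n + 1))) := by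
  constructor
  · rw [sub_eq_add_neg, ← tsum_neg]
    congr 2
    funext n
    rw [mul_div_assoc, fs_inv q hq hq0 n, mul_div_assoc]
    ring
  · rw [fs_psi q hq hq0]
    simp only [fs_b q hq]
    have s := fsU_summable q hq hq0 0
    have s' := (summable_nat_add_iff 1).2 s
    rw [tsum_neg, s.tsum_add s']
    have h := s.tsum_eq_zero_add
    have h0 : fsU q 0 0 = 1 := by simp [fsU, qPoch]
    rw [h0] at h
    linear_combination -h
end

section
/- Ramanujan's identity: for |q|<1 and a ≠ 0 with a ≠ −q^{∓ℓ}, ∑_{n≥0} q^n/((−aq;q)_n (−a^{-1}q;q)_n) = (1+a) ∑_{n≥0} a^{3n} q^{n(3n+1)/2}(1 − a² q^{2n+1}) − a/((−aq;q)_∞ (−a^{-1}q;q)_∞) · ∑_{n≥0} (−1)^n a^{2n} q^{n(n+1)/2}. -/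
noncomputable def qPochInf (a q : ℂ) : ℂ :=
  ∏' j : ℕ, (1 - a * q ^ j)

open Filter Topology

namespace Ram

lemma qPoch_succ (x q : ℂ) (n : ℕ) : qPoch x q (n+1) = qPoch x q n * (1 - x * q ^ n) := by
  simp [qPoch, Finset.prod_range_succ]

lemma qPoch_succ' (x q : ℂ) (n : ℕ) : qPoch x q (n+1) = (1 - x) * qPoch (x * q) q n := by
  simp only [qPoch, Finset.prod_range_succ', pow_zero, mul_one]
  rw [mul_comm]
  congr 1
  apply Finset.prod_congr rfl
  intro j _
  ring

def Good (a q : ℂ) : Prop := a ≠ 0 ∧ ∀ ℓ : ℤ, a ≠ -(q ^ ℓ)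

lemma Good.shift {a q : ℂ} (hq0 : q ≠ 0) (h : Good a q) (N : ℤ) : Good (a * q ^ N) q := by
  refine ⟨mul_ne_zero h.1 (zpow_ne_zero _ hq0), fun l hl => h.2 (l - N) ?_⟩
  rw [zpow_sub₀ hq0, ← neg_div, ← hl]
  field_simp

lemma Good.inv {a q : ℂ} (h : Good a q) : Good a⁻¹ q := by
  refine ⟨inv_ne_zero h.1, fun l hl => h.2 (-l) ?_⟩
  rw [zpow_neg, ← inv_neg, ← hl, inv_inv]

lemma Good.ne {a q : ℂ} (hq0 : q ≠ 0) (h : Good a q) (m : ℤ) : 1 + a * q ^ m ≠ 0 := by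
  intro h0
  apply (h.shift hq0 m).2 0
  rw [zpow_zero]
  linear_combination h0

lemma lower {a q : ℂ} (hq : ‖q‖ < 1) (hq0 : q ≠ 0) (h : Good a q) :
    ∃ C : ℝ, 0 ≤ C ∧ ∀ k : ℕ, ‖(1 + a * q ^ k)⁻¹‖ ≤ C := by
  have ht : Tendsto (fun k : ℕ => (1 + a * q ^ k)⁻¹) atTop (𝓝 (1 + a * 0)⁻¹) := by
    apply Tendsto.inv₀
    · exact ((tendsto_pow_atTop_nhds_zero_of_norm_lt_one hq).const_mul a).const_add 1
    · simp
  obtain ⟨C, hC⟩ := (Metric.isBounded_range_of_tendsto _ ht).exists_norm_le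
  refine ⟨C, (norm_nonneg _).trans (hC _ ⟨0, rfl⟩), fun k => hC _ ⟨k, rfl⟩⟩

lemma factor {a q : ℂ} (hq : ‖q‖ < 1) (hq0 : q ≠ 0) (h : Good a q) :
    ∃ C : ℝ, 0 ≤ C ∧ ∀ m : ℤ, ‖(1 + a * q ^ m)⁻¹‖ ≤ 1 + C * ‖q‖ ^ m.natAbs := by
  obtain ⟨C1, h1, hC1⟩ := lower hq hq0 h
  obtain ⟨C2, h2, hC2⟩ := lower hq hq0 h.inv
  have key : ∀ k : ℕ, (1 + a * q ^ k) ≠ 0 := fun k => by simpa using h.ne hq0 k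
  have key2 : ∀ k : ℕ, (1 + a⁻¹ * q ^ k) ≠ 0 := fun k => by simpa using h.inv.ne hq0 k
  have ha := h.1
  refine ⟨C1 * ‖a‖ + C2 * ‖a⁻¹‖, by positivity, fun m => ?_⟩
  obtain ⟨k, rfl | rfl⟩ := m.eq_nat_or_neg
  · have e : (1 + a * q ^ (k:ℤ))⁻¹ = 1 - (1 + a * q ^ k)⁻¹ * a * q ^ k := by
      have := key k
      rw [zpow_natCast]; field_simp; ring
    rw [e]
    refine (norm_sub_le _ _).trans ?_
    rw [norm_mul, norm_mul, norm_pow, norm_one, Int.natAbs_natCast]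
    have := hC1 k
    have h3 : ‖(1 + a * q ^ k)⁻¹‖ * ‖a‖ ≤ C1 * ‖a‖ + C2 * ‖a⁻¹‖ := by
      have : 0 ≤ C2 * ‖a⁻¹‖ := by positivity
      have : ‖(1 + a * q ^ k)⁻¹‖ * ‖a‖ ≤ C1 * ‖a‖ := by gcongr
      linarith
    gcongr
  · have e : (1 + a * q ^ (-(k:ℤ)))⁻¹ = (1 + a⁻¹ * q ^ k)⁻¹ * a⁻¹ * q ^ k := by
      have := key2 k
      have h4 : 1 + a * q ^ (-(k:ℤ)) = (1 + a⁻¹ * q ^ k) * a * (q ^ k)⁻¹ := by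
        rw [zpow_neg, zpow_natCast]; field_simp; ring
      rw [h4, mul_inv, mul_inv, inv_inv]
    rw [e, norm_mul, norm_mul, norm_pow, Int.natAbs_neg, Int.natAbs_natCast]
    have := hC2 k
    have h3 : ‖(1 + a⁻¹ * q ^ k)⁻¹‖ * ‖a⁻¹‖ ≤ C1 * ‖a‖ + C2 * ‖a⁻¹‖ := by
      have : 0 ≤ C1 * ‖a‖ := by positivity
      have : ‖(1 + a⁻¹ * q ^ k)⁻¹‖ * ‖a⁻¹‖ ≤ C2 * ‖a⁻¹‖ := by gcongr
      linarith
    have : ‖(1 + a⁻¹ * q ^ k)⁻¹‖ * ‖a⁻¹‖ * ‖q‖ ^ k ≤ (C1 * ‖a‖ + C2 * ‖a⁻¹‖) * ‖q‖ ^ k := by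
      gcongr
    linarith

lemma prod_bound {a q : ℂ} (hq : ‖q‖ < 1) (hq0 : q ≠ 0) (h : Good a q) :
    ∃ C : ℝ, 0 ≤ C ∧ ∀ (N : ℤ) (n : ℕ), ‖(qPoch (-(a * q ^ N)) q n)⁻¹‖ ≤ C := by
  obtain ⟨C, hC0, hC⟩ := factor hq hq0 h
  have hs : Summable (fun m : ℤ => C * ‖q‖ ^ m.natAbs) := by
    apply Summable.mul_left
    apply Summable.of_nat_of_neg <;>
      simpa using summable_geometric_of_lt_one (norm_nonneg q) hq
  refine ⟨Real.exp (∑' m : ℤ, C * ‖q‖ ^ m.natAbs), (Real.exp_pos _).le, fun N n => ?_⟩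
  have hinj : Function.Injective (fun j : ℕ => N + (j:ℤ)) := fun i j hij => by simpa using hij
  calc ‖(qPoch (-(a * q ^ N)) q n)⁻¹‖
      = ∏ j ∈ Finset.range n, ‖(1 + a * q ^ (N + (j:ℤ)))⁻¹‖ := by
        rw [qPoch, ← Finset.prod_inv_distrib, norm_prod]
        apply Finset.prod_congr rfl
        intro j _
        rw [zpow_add₀ hq0, zpow_natCast]
        congr 2
        ring
    _ ≤ ∏ j ∈ Finset.range n, Real.exp (C * ‖q‖ ^ (N + (j:ℤ)).natAbs) := by
        apply Finset.prod_le_prod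
        · intros; positivity
        · intro j _
          refine (hC _).trans ?_
          rw [add_comm]
          exact Real.add_one_le_exp _
    _ = Real.exp (∑ m ∈ (Finset.range n).map ⟨_, hinj⟩, C * ‖q‖ ^ m.natAbs) := by
        rw [← Real.exp_sum, Finset.sum_map]; rfl
    _ ≤ _ := by
        apply Real.exp_le_exp.mpr
        exact hs.sum_le_tsum _ (fun _ _ => by positivity)

lemma tendsto_qPoch (x : ℂ) {q : ℂ} (hq : ‖q‖ < 1) :
    Tendsto (fun n => qPoch x q n) atTop (𝓝 (qPochInf x q)) := by
  have hm : Multipliable (fun j : ℕ => 1 - x * q ^ j) := by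
    have : Summable (fun j : ℕ => ‖-(x * q ^ j)‖) := by
      simp only [norm_neg, norm_mul, norm_pow]
      exact (summable_geometric_of_lt_one (norm_nonneg q) hq).mul_left _
    simpa [sub_eq_add_neg] using multipliable_one_add_of_summable this
  exact hm.hasProd.tendsto_prod_nat

lemma qPochInf_shift (x : ℂ) {q : ℂ} (hq : ‖q‖ < 1) :
    qPochInf x q = (1 - x) * qPochInf (x * q) q := by
  refine tendsto_nhds_unique ((tendsto_add_atTop_iff_nat 1).2 (tendsto_qPoch x hq)) ?_
  simp only [qPoch_succ']
  exact (tendsto_qPoch (x * q) hq).const_mul _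

lemma inf_bound {x q : ℂ} (hq : ‖q‖ < 1) {C : ℝ} (h0 : ∀ n, qPoch x q n ≠ 0)
    (h : ∀ n, ‖(qPoch x q n)⁻¹‖ ≤ C) :
    qPochInf x q ≠ 0 ∧ ‖(qPochInf x q)⁻¹‖ ≤ C := by
  have ht := tendsto_qPoch x hq
  have hne : qPochInf x q ≠ 0 := by
    intro hz
    rw [hz] at ht
    have h1 : ∀ n, 1 ≤ C * ‖qPoch x q n‖ := fun n => by
      have h2 := mul_le_mul_of_nonneg_right (h n) (norm_nonneg (qPoch x q n))
      rwa [← norm_mul, inv_mul_cancel₀ (h0 n), norm_one] at h2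
    have h3 : Tendsto (fun n => C * ‖qPoch x q n‖) atTop (𝓝 (C * ‖(0:ℂ)‖)) := ht.norm.const_mul C
    have := ge_of_tendsto' h3 h1
    simp at this
    linarith
  exact ⟨hne, le_of_tendsto' (ht.inv₀ hne).norm h⟩

lemma qPoch_ne {a q : ℂ} (hq0 : q ≠ 0) (h : Good a q) (n : ℕ) (N : ℤ) :
    qPoch (-(a * q ^ N)) q n ≠ 0 := by
  apply Finset.prod_ne_zero_iff.2
  intro j _
  have := h.ne hq0 (N + j)
  rw [zpow_add₀ hq0, zpow_natCast] at this
  convert this using 1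
  ring

lemma S_summable (c r : ℝ) (hc : 0 ≤ c) (hr : 0 ≤ r) (hr1 : r < 1) :
    Summable (fun n : ℕ => c ^ n * r ^ (n * (n + 1) / 2)) := by
  have ht : Tendsto (fun n : ℕ => c * r ^ (n+1)) atTop (𝓝 (c * 0)) :=
    ((tendsto_add_atTop_iff_nat 1).2 (tendsto_pow_atTop_nhds_zero_of_lt_one hr hr1)).const_mul c
  rw [mul_zero] at ht
  have he := ht.eventually_le_const (show (0:ℝ) < 1/2 by norm_num)
  refine summable_of_ratio_norm_eventually_le (r := 1/2) (by norm_num) ?_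
  filter_upwards [he] with n hn
  rw [Real.norm_of_nonneg (by positivity), Real.norm_of_nonneg (by positivity)]
  have : (n+1) * (n+1+1) / 2 = n * (n+1) / 2 + (n+1) := by
    rw [show (n+1) * (n+1+1) = n * (n+1) + (n+1) * 2 by ring, Nat.add_mul_div_right _ _ two_pos]
  rw [this, pow_succ, pow_add]
  calc _ = (c * r ^ (n+1)) * (c ^ n * r ^ (n * (n + 1) / 2)) := by ring
    _ ≤ _ := by gcongr

noncomputable def R1t (a q : ℂ) (n : ℕ) : ℂ :=
  a ^ (3 * n) * q ^ (n * (3 * n + 1) / 2) * (1 - a ^ 2 * q ^ (2 * n + 1))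
noncomputable def Tt (a q : ℂ) (n : ℕ) : ℂ := (-1) ^ n * a ^ (2 * n) * q ^ (n * (n + 1) / 2)

lemma R1t_bound {a q : ℂ} (hq : ‖q‖ < 1) {α : ℝ} (ha : ‖a‖ ≤ α) (n : ℕ) :
    ‖R1t a q n‖ ≤ (α ^ 3) ^ n * ‖q‖ ^ (n * (n + 1) / 2) * (1 + α ^ 2) := by
  have hα := (norm_nonneg a).trans ha
  rw [R1t, norm_mul, norm_mul, norm_pow, norm_pow, ← pow_mul]
  have h1 : ‖q‖ ^ (n * (3 * n + 1) / 2) ≤ ‖q‖ ^ (n * (n + 1) / 2) := by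
    apply pow_le_pow_of_le_one (norm_nonneg _) hq.le
    apply Nat.div_le_div_right
    apply Nat.mul_le_mul_left
    omega
  have h2 : ‖1 - a ^ 2 * q ^ (2 * n + 1)‖ ≤ 1 + α ^ 2 := by
    refine (norm_sub_le _ _).trans ?_
    rw [norm_one, norm_mul, norm_pow, norm_pow]
    have : ‖q‖ ^ (2 * n + 1) ≤ 1 := pow_le_one₀ (norm_nonneg _) hq.le
    have : ‖a‖ ^ 2 * ‖q‖ ^ (2 * n + 1) ≤ α ^ 2 * 1 := by gcongr
    linarith
  gcongr

lemma Tt_bound {a q : ℂ} {α : ℝ} (ha : ‖a‖ ≤ α) (n : ℕ) :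
    ‖Tt a q n‖ ≤ (α ^ 2) ^ n * ‖q‖ ^ (n * (n + 1) / 2) := by
  rw [Tt, norm_mul, norm_mul, norm_pow, norm_pow, norm_pow, ← pow_mul, norm_neg, norm_one, one_pow,
    one_mul]
  gcongr

lemma R1_sum (a : ℂ) {q : ℂ} (hq : ‖q‖ < 1) : Summable (R1t a q) :=
  Summable.of_norm_bounded ((S_summable (‖a‖^3) _ (by positivity) (norm_nonneg q) hq).mul_right _)
    (R1t_bound hq le_rfl)

lemma T_sum (a : ℂ) {q : ℂ} (hq : ‖q‖ < 1) : Summable (Tt a q) :=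
  Summable.of_norm_bounded (S_summable (‖a‖^2) _ (by positivity) (norm_nonneg q) hq)
    (Tt_bound le_rfl)

lemma R1_shift (a : ℂ) {q : ℂ} (hq : ‖q‖ < 1) :
    ∑' n, R1t a q n = 1 - a ^ 2 * q + a ^ 3 * q ^ 2 * ∑' n, R1t (a * q) q n := by
  rw [(R1_sum a hq).tsum_eq_zero_add, ← tsum_mul_left]
  congr 1
  · simp [R1t]
  · congr 1; ext n
    have : (n+1) * (3*(n+1)+1) / 2 = n * (3*n+1) / 2 + (3*n+2) := by
      rw [show (n+1) * (3*(n+1)+1) = n * (3*n+1) + (3*n+2) * 2 by ring,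
        Nat.add_mul_div_right _ _ two_pos]
    rw [R1t, R1t, this]
    ring

lemma T_shift (a : ℂ) {q : ℂ} (hq : ‖q‖ < 1) :
    ∑' n, Tt a q n = 1 - a ^ 2 * q + a ^ 4 * q ^ 3 * ∑' n, Tt (a * q) q n := by
  rw [(T_sum a hq).tsum_eq_zero_add, ((summable_nat_add_iff 1).2 (T_sum a hq)).tsum_eq_zero_add,
    ← tsum_mul_left, ← add_assoc]
  congr 1
  · simp [Tt]; ring
  · congr 1; ext n
    have : (n+1+1) * (n+1+1+1) / 2 = n * (n+1) / 2 + (2*n+3) := by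
      rw [show (n+1+1) * (n+1+1+1) = n * (n+1) + (2*n+3) * 2 by ring,
        Nat.add_mul_div_right _ _ two_pos]
    rw [Tt, Tt, this]
    ring

noncomputable def D (a q : ℂ) (n : ℕ) : ℂ := qPoch (-a) q (n+1) * qPoch (-a⁻¹ * q) q n
noncomputable def DI (a q : ℂ) : ℂ := qPochInf (-a) q * qPochInf (-a⁻¹ * q) q

lemma D_bound {a q : ℂ} (hq : ‖q‖ < 1) (hq0 : q ≠ 0) (h : Good a q) :
    ∃ C : ℝ, 0 ≤ C ∧ ∀ N : ℕ, (∀ n, D (a * q ^ N) q n ≠ 0) ∧ DI (a * q ^ N) q ≠ 0 ∧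
      (∀ n, ‖(D (a * q ^ N) q n)⁻¹‖ ≤ C) ∧ ‖(DI (a * q ^ N) q)⁻¹‖ ≤ C := by
  obtain ⟨C1, h1, hC1⟩ := prod_bound hq hq0 h
  obtain ⟨C2, h2, hC2⟩ := prod_bound hq hq0 h.inv
  have e1 : ∀ N : ℕ, -(a * q ^ N) = -(a * q ^ (N:ℤ)) := fun N => by simp
  have e2 : ∀ N : ℕ, -(a * q ^ N)⁻¹ * q = -(a⁻¹ * q ^ (1 - N : ℤ)) := fun N => by
    rw [zpow_sub₀ hq0]; simp; field_simp
  refine ⟨C1 * C2, by positivity, fun N => ?_⟩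
  have i1 := inf_bound hq (qPoch_ne hq0 h · N) (hC1 N)
  have i2 := inf_bound hq (qPoch_ne hq0 h.inv · (1 - N)) (hC2 (1-N))
  simp only [D, DI, e2]
  rw [e1]
  refine ⟨fun n => mul_ne_zero (qPoch_ne hq0 h _ _) (qPoch_ne hq0 h.inv _ _),
    mul_ne_zero i1.1 i2.1, fun n => ?_, ?_⟩
  · rw [mul_inv, norm_mul]
    gcongr
    · exact hC1 _ _
    · exact hC2 _ _
  · rw [mul_inv, norm_mul]
    gcongr
    · exact i1.2
    · exact i2.2

lemma D_tendsto (a : ℂ) {q : ℂ} (hq : ‖q‖ < 1) : Tendsto (D a q) atTop (𝓝 (DI a q)) :=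
  ((tendsto_add_atTop_iff_nat 1).2 (tendsto_qPoch _ hq)).mul (tendsto_qPoch _ hq)

lemma D_succ {a : ℂ} (q : ℂ) (n : ℕ) (ha : a ≠ 0) :
    D a q (n+1) * a = D a q n * ((1 + a * q ^ (n+1)) * (a + q ^ (n+1))) := by
  have h4 : a * a⁻¹ = 1 := mul_inv_cancel₀ ha
  rw [D, D, qPoch_succ _ _ (n+1), qPoch_succ (-a⁻¹ * q) _ n]
  linear_combination qPoch (-a) q (n+1) * qPoch (-a⁻¹ * q) q n * (1 + a * q ^ (n+1)) * q ^ (n+1) * h4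

lemma D_shift {a q : ℂ} (n : ℕ) (ha : a ≠ 0) (hq0 : q ≠ 0) :
    D (a * q) q n * (a + q ^ n) = D a q n * (1 + a * q ^ (n+1)) := by
  have e : -(a * q)⁻¹ * q = -a⁻¹ := by field_simp
  have h1 := qPoch_succ' (-a) q (n+1)
  rw [qPoch_succ] at h1
  have h2 := qPoch_succ' (-a⁻¹) q n
  rw [qPoch_succ] at h2
  rw [D, D, e, show -(a * q) = -a * q by ring]
  have h3 : a + q ^ n = a * (1 - -a⁻¹ * q ^ n) := by field_simp; ring
  rw [h3]
  have h4 : a * (1 - -a⁻¹) = 1 - -a := by field_simp; ring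
  linear_combination qPoch (-a * q) q (n + 1) * a * h2 - qPoch (-a⁻¹ * q) q n * h1
    + qPoch (-a * q) q (n + 1) * qPoch (-a⁻¹ * q) q n * h4

lemma DI_shift {a q : ℂ} (hq : ‖q‖ < 1) (ha : a ≠ 0) (hq0 : q ≠ 0) :
    DI (a * q) q * a = DI a q := by
  have e : -(a * q)⁻¹ * q = -a⁻¹ := by field_simp
  have h1 := qPochInf_shift (-a) hq
  have h2 := qPochInf_shift (-a⁻¹) hq
  rw [DI, DI, e, h1, h2, show -(a * q) = -a * q by ring]
  field_simp
  ring

noncomputable def L (a q : ℂ) : ℂ := ∑' n, q ^ n / D a q n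
noncomputable def G (a q : ℂ) : ℂ := ∑' n, R1t a q n - a / DI a q * ∑' n, Tt a q n

lemma L_summable {a q : ℂ} (hq : ‖q‖ < 1) (hq0 : q ≠ 0) (h : Good a q) :
    Summable (fun n => q ^ n / D a q n) := by
  obtain ⟨C, hC, hb⟩ := D_bound hq hq0 h
  have := (hb 0).2.2.1
  simp only [pow_zero, mul_one] at this
  refine Summable.of_norm_bounded
    ((summable_geometric_of_lt_one (norm_nonneg q) hq).mul_right C) fun n => ?_
  rw [div_eq_mul_inv, norm_mul, norm_pow]
  gcongr
  exact this n

lemma good_q {a q : ℂ} (hq0 : q ≠ 0) (h : Good a q) : Good (a * q) q := by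
  simpa using h.shift hq0 1

lemma L_shift {a q : ℂ} (hq : ‖q‖ < 1) (hq0 : q ≠ 0) (h : Good a q) :
    L a q = (1 - a ^ 2 * q) * (1 - a / DI a q) + a ^ 3 * q ^ 2 * L (a * q) q := by
  have ha := h.1
  obtain ⟨C, hC, hb⟩ := D_bound hq hq0 h
  have hD := (hb 0).1
  have hDI := (hb 0).2.1
  have hD' := (hb 1).1
  simp only [pow_zero, mul_one, pow_one] at hD hDI hD'
  have s1 := L_summable hq hq0 h
  have s2 := (L_summable hq hq0 (good_q hq0 h)).mul_left (a ^ 3 * q ^ 2)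
  let U : ℕ → ℂ := fun n => -(1 - a ^ 2 * q) * (a + q ^ n) / D a q n
  have hstep : ∀ n, q ^ n / D a q n - a ^ 3 * q ^ 2 * (q ^ n / D (a * q) q n) = U (n+1) - U n := by
    intro n
    have n1 : a + q ^ n ≠ 0 := by
      intro h0; apply h.2 n; rw [zpow_natCast]; linear_combination h0
    have n2 : a + q ^ (n+1) ≠ 0 := by
      intro h0; apply h.2 (n+1 : ℕ); rw [zpow_natCast]; linear_combination h0
    have n3 : 1 + a * q ^ (n+1) ≠ 0 := by
      have := h.ne hq0 (n+1 : ℕ); rwa [zpow_natCast] at this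
    have e1 : D a q (n+1) = D a q n * ((1 + a * q ^ (n+1)) * (a + q ^ (n+1))) / a := by
      rw [eq_div_iff ha]; exact D_succ q n ha
    have e2 : D (a*q) q n = D a q n * (1 + a * q ^ (n+1)) / (a + q ^ n) := by
      rw [eq_div_iff n1]; exact D_shift n ha hq0
    have := hD n
    simp only [U, e1, e2]
    field_simp
    ring
  have hlim : Tendsto U atTop (𝓝 (-(1 - a ^ 2 * q) * (a + 0) / DI a q)) := by
    apply Tendsto.div _ (D_tendsto a hq) hDI
    exact ((tendsto_pow_atTop_nhds_zero_of_norm_lt_one hq).const_add a).const_mul _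
  have hsum := (s1.sub s2).hasSum.tendsto_sum_nat
  simp only [hstep, Finset.sum_range_sub] at hsum
  have := tendsto_nhds_unique hsum (hlim.sub_const (U 0))
  rw [← tsum_congr hstep, s1.tsum_sub s2, tsum_mul_left] at this
  have h1 : 1 + a ≠ 0 := by simpa using h.ne hq0 0
  have hU0 : U 0 = -(1 - a ^ 2 * q) := by
    simp only [U, D, qPoch]
    simp
    field_simp
    ring
  rw [hU0] at this
  rw [L, L]
  linear_combination this

lemma G_shift {a q : ℂ} (hq : ‖q‖ < 1) (hq0 : q ≠ 0) (h : Good a q) :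
    G a q = (1 - a ^ 2 * q) * (1 - a / DI a q) + a ^ 3 * q ^ 2 * G (a * q) q := by
  have ha := h.1
  obtain ⟨C, hC, hb⟩ := D_bound hq hq0 h
  have hDI := (hb 1).2.1
  simp only [pow_one] at hDI
  rw [G, G, R1_shift a hq, T_shift a hq, ← DI_shift hq ha hq0]
  field_simp
  ring

theorem H_bound {a q : ℂ} (hq : ‖q‖ < 1) (hq0 : q ≠ 0) (h : Good a q) :
    ∃ K : ℝ, ∀ N : ℕ, ‖L (a * q ^ N) q - G (a * q ^ N) q‖ ≤ K := by
  obtain ⟨C, hC, hb⟩ := D_bound hq hq0 h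
  have sg := summable_geometric_of_lt_one (norm_nonneg q) hq
  have s1 := (S_summable (‖a‖^3) _ (by positivity) (norm_nonneg q) hq).mul_right (1 + ‖a‖^2)
  have s2 := S_summable (‖a‖^2) _ (by positivity) (norm_nonneg q) hq
  refine ⟨_, fun N => (norm_sub_le _ _).trans (add_le_add
    (tsum_of_norm_bounded (sg.mul_right C).hasSum fun n => ?_)
    ((norm_sub_le _ _).trans (add_le_add (tsum_of_norm_bounded s1.hasSum fun n => ?_)
      ((norm_mul_le _ _).trans (mul_le_mul (b := ‖a‖ * C) ?_
        (tsum_of_norm_bounded s2.hasSum fun n => ?_) (norm_nonneg _) (by positivity))))))⟩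
  all_goals
    have hN : ‖a * q ^ N‖ ≤ ‖a‖ := by
      rw [norm_mul, norm_pow]
      exact mul_le_of_le_one_right (norm_nonneg _) (pow_le_one₀ (norm_nonneg _) hq.le)
  · rw [div_eq_mul_inv, norm_mul, norm_pow]
    gcongr
    exact (hb N).2.2.1 n
  · exact R1t_bound hq hN n
  · rw [div_eq_mul_inv, norm_mul]
    gcongr
    exact (hb N).2.2.2
  · exact Tt_bound hN n

theorem L_eq_G {a q : ℂ} (hq : ‖q‖ < 1) (hq0 : q ≠ 0) (h : Good a q) : L a q = G a q := by
  obtain ⟨K, hK⟩ := H_bound hq hq0 h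
  have hrec : ∀ N : ℕ, ‖L a q - G a q‖ ≤
      ((‖a‖^3) ^ N * ‖q‖ ^ (N * (N + 1) / 2)) * ‖L (a * q ^ N) q - G (a * q ^ N) q‖ := by
    intro N
    induction N with
    | zero => simp
    | succ N ih =>
      refine ih.trans ?_
      have hg : Good (a * q ^ N) q := by simpa using h.shift hq0 N
      rw [L_shift hq hq0 hg, G_shift hq hq0 hg, add_sub_add_left_eq_sub, ← mul_sub, norm_mul,
        mul_assoc a, ← pow_succ, ← mul_assoc]
      have : (N+1) * (N+1+1) / 2 = N * (N+1) / 2 + (N+1) := by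
        rw [show (N+1) * (N+1+1) = N * (N+1) + (N+1) * 2 by ring,
          Nat.add_mul_div_right _ _ two_pos]
      rw [this]
      apply mul_le_mul_of_nonneg_right _ (norm_nonneg _)
      have e : ‖(a * q ^ N) ^ 3 * q ^ 2‖ = ‖a‖ ^ 3 * ‖q‖ ^ (3 * N + 2) := by
        simp only [norm_mul, norm_pow]; ring
      rw [e]
      have h5 : ‖q‖ ^ (3 * N + 2) ≤ ‖q‖ ^ (N + 1) :=
        pow_le_pow_of_le_one (norm_nonneg _) hq.le (by omega)
      calc _ ≤ (‖a‖ ^ 3) ^ N * ‖q‖ ^ (N * (N + 1) / 2) * (‖a‖ ^ 3 * ‖q‖ ^ (N + 1)) := by gcongr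
        _ = _ := by ring
  have ht := ((S_summable (‖a‖^3) _ (by positivity) (norm_nonneg q)
    hq).tendsto_atTop_zero).mul_const K
  rw [zero_mul] at ht
  have := ge_of_tendsto' ht fun N => (hrec N).trans
    (mul_le_mul_of_nonneg_left (hK N) (by positivity))
  exact sub_eq_zero.1 (norm_le_zero_iff.1 this)

end Ram



theorem ramanujan_1_1 (a q : ℂ) (hq : ‖q‖ < 1) (ha : a ≠ 0)
    (ha' : ∀ ℓ : ℤ, a ≠ -(q ^ ℓ)) :
    ∑' n : ℕ, q ^ n / (qPoch (-a * q) q n * qPoch (-a⁻¹ * q) q n)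
      = (1 + a) * ∑' n : ℕ, a ^ (3 * n) * q ^ (n * (3 * n + 1) / 2) * (1 - a ^ 2 * q ^ (2 * n + 1))
        - a / (qPochInf (-a * q) q * qPochInf (-a⁻¹ * q) q)
            * ∑' n : ℕ, (-1) ^ n * a ^ (2 * n) * q ^ (n * (n + 1) / 2) := by
  have h1 : 1 + a ≠ 0 := by
    intro h0; apply ha' 0; rw [zpow_zero]; linear_combination h0
  by_cases hq0 : q = 0
  · subst hq0
    rw [tsum_eq_single 0, tsum_eq_single 0, tsum_eq_single 0]
    · simp [qPoch, qPochInf]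
    · intro n hn
      have : n * (n + 1) / 2 ≠ 0 := by
        have : 1 ≤ n := by omega
        have : 2 ≤ n * (n + 1) := by nlinarith
        omega
      simp [this]
    · intro n hn
      have : n * (3 * n + 1) / 2 ≠ 0 := by
        have : 1 ≤ n := by omega
        have : 2 ≤ n * (3 * n + 1) := by nlinarith
        omega
      simp [this]
    · intro n hn
      simp [hn]
  have key := Ram.L_eq_G hq hq0 ⟨ha, ha'⟩
  have e1 : ∀ n : ℕ, q ^ n / (qPoch (-a * q) q n * qPoch (-a⁻¹ * q) q n)
      = (1 + a) * (q ^ n / Ram.D a q n) := by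
    intro n
    rw [Ram.D, Ram.qPoch_succ', sub_neg_eq_add, mul_assoc, ← mul_div_assoc,
      mul_div_mul_left _ _ h1]
  rw [tsum_congr e1, tsum_mul_left]
  change (1 + a) * Ram.L a q = (1 + a) * ∑' n, Ram.R1t a q n - _ * ∑' n, Ram.Tt a q n
  have e2 : a / (qPochInf (-a * q) q * qPochInf (-a⁻¹ * q) q) = (1 + a) * (a / Ram.DI a q) := by
    rw [Ram.DI, Ram.qPochInf_shift (-a) hq, sub_neg_eq_add, mul_assoc, ← mul_div_assoc,
      mul_div_mul_left _ _ h1]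
  rw [key, e2, Ram.G]
  ring
end
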